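/- Let W be the free monoid on the alphabet {1,…,n} and H = ℓ²(W). For a nonempty word w = i_1⋯i_p ∈ W define two vectors in H^n: G_w := (Σ_{1≤k≤p, i_k=j} e_{i_{k+1}⋯i_p i_1⋯i_{k−1}})_{1≤j≤n} (the evaluation at the left creation operators of the cyclic gradient of the monomial X_{i_1}⋯X_{i_p}, applied to the vacuum), and F_w := ((ℓ_j* − r_j*) e_w)_{1≤j≤n}, whose j-th component equals [i_1 = j]·e_{i_2⋯i_p} − [i_p = j]·e_{i_1⋯i_{p−1}}. Then, in the Hilbert space H^n, the orthogonal complement of the closed linear span of { G_w : w ∈ W } equals the closed linear span of { F_w : w ∈ W, w nonempty }. -/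

import Mathlib

open scoped BigOperators

/-- `G_w ∈ H^n`: the cyclic gradient of the monomial of the word `w`, evaluated at the
left creation operators and applied to the vacuum; its `j`-th component is
`Σ_{k : w_k = j} e_{w_{k+1}⋯w_p w_1⋯w_{k−1}}` (and `G_∅ = 0`). -/
noncomputable def cycGradVec {n : ℕ} {H : Type*}
    [NormedAddCommGroup H] [InnerProductSpace ℂ H] [CompleteSpace H]
    (b : HilbertBasis (FreeMonoid (Fin n)) ℂ H) (w : FreeMonoid (Fin n)) :
    PiLp 2 (fun _ : Fin n => H) :=
  (WithLp.equiv 2 (Fin n → H)).symm fun j =>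
    ∑ m : Fin (FreeMonoid.toList w).length,
      if (FreeMonoid.toList w).get m = j then
        b (FreeMonoid.ofList
            (((FreeMonoid.toList w).drop (m + 1)) ++ ((FreeMonoid.toList w).take m)))
      else 0

/-- `F_w = ((ℓ_j* − r_j*) e_w)_j ∈ H^n`. -/
noncomputable def creationDiffVec {n : ℕ} {H : Type*}
    [NormedAddCommGroup H] [InnerProductSpace ℂ H] [CompleteSpace H]
    (b : HilbertBasis (FreeMonoid (Fin n)) ℂ H) (L Rop : Fin n → H →L[ℂ] H)
    (w : FreeMonoid (Fin n)) : PiLp 2 (fun _ : Fin n => H) :=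
  (WithLp.equiv 2 (Fin n → H)).symm fun j =>
    (ContinuousLinearMap.adjoint (L j) - ContinuousLinearMap.adjoint (Rop j)) (b w)

section

variable {n : ℕ} {H : Type*} [NormedAddCommGroup H] [InnerProductSpace ℂ H]

lemma inner_single_left (j : Fin n) (a : H) (x : PiLp 2 (fun _ : Fin n => H)) :
    inner ℂ (PiLp.single 2 j a) x = inner ℂ a (x j) := by
  rw [PiLp.inner_apply, Finset.sum_eq_single j]
  · simp
  · intro i _ hi
    rw [PiLp.single_eq_of_ne 2 hi, inner_zero_left]
  · simp

lemma HilbertBasis.ext_inner_left {ι : Type*} (b : HilbertBasis ι ℂ H) {x y : H}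
    (h : ∀ i, inner ℂ (b i) x = inner ℂ (b i) y) : x = y := by
  apply b.repr.injective
  ext i
  simpa only [b.repr_apply_apply] using h i

lemma HilbertBasis.inner_eq_ite {ι : Type*} [DecidableEq ι] (b : HilbertBasis ι ℂ H) (i j : ι) :
    inner ℂ (b i) (b j) = if i = j then 1 else 0 :=
  orthonormal_iff_ite.mp b.orthonormal i j

/-- The vector of `H^n` attached to a word: `j·v` goes to the vector with `j`-th component `e_v` and
all other components zero. On nonempty words this is an orthonormal basis of `H^n`; the empty word
goes to zero. -/
noncomputable def wordVec (b : HilbertBasis (FreeMonoid (Fin n)) ℂ H) :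
    List (Fin n) → PiLp 2 (fun _ : Fin n => H)
  | [] => 0
  | j :: v => PiLp.single 2 j (b (FreeMonoid.ofList v))

lemma inner_wordVec_wordVec (b : HilbertBasis (FreeMonoid (Fin n)) ℂ H)
    {u : List (Fin n)} (hu : u ≠ []) (v : List (Fin n)) :
    inner ℂ (wordVec b u) (wordVec b v) = if u = v then 1 else 0 := by
  classical
  cases u with
  | nil => exact absurd rfl hu
  | cons i u =>
    cases v with
    | nil => simp [wordVec]
    | cons j v =>
      rw [wordVec, wordVec, inner_single_left]
      by_cases hij : i = j
      · subst hij
        simp [b.inner_eq_ite]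
      · simp [hij]

lemma eq_zero_of_inner_wordVec_eq_zero (b : HilbertBasis (FreeMonoid (Fin n)) ℂ H)
    {x : PiLp 2 (fun _ : Fin n => H)}
    (h : ∀ u : List (Fin n), u ≠ [] → inner ℂ (wordVec b u) x = 0) : x = 0 := by
  ext j
  refine b.ext_inner_left fun v => ?_
  have := h (j :: FreeMonoid.toList v) (List.cons_ne_nil _ _)
  rw [wordVec, inner_single_left] at this
  simpa using this

lemma inner_sum_rotate_wordVec_sub (b : HilbertBasis (FreeMonoid (Fin n)) ℂ H)
    (v u : List (Fin n)) :
    inner ℂ (∑ m ∈ Finset.range v.length, wordVec b (v.rotate m))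
      (wordVec b (u.rotate 1) - wordVec b u) = 0 := by
  rcases eq_or_ne v [] with rfl | hv
  · simp
  have hne : ∀ m, v.rotate m ≠ [] := fun m h => hv (List.rotate_eq_nil_iff.mp h)
  have hterm : ∀ m, inner ℂ (wordVec b (v.rotate m)) (wordVec b (u.rotate 1) - wordVec b u) =
      (if v.rotate m = u.rotate 1 then (1 : ℂ) else 0) -
        if v.rotate (m + 1) = u.rotate 1 then 1 else 0 := by
    intro m
    rw [inner_sub_right, inner_wordVec_wordVec b (hne m), inner_wordVec_wordVec b (hne m),
      ← List.rotate_rotate]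
    simp only [List.rotate_eq_rotate]
  rw [sum_inner, Finset.sum_congr rfl fun m _ => hterm m,
    Finset.sum_range_sub' fun m => if v.rotate m = u.rotate 1 then (1 : ℂ) else 0]
  simp

variable [CompleteSpace H]

lemma cycGradVec_eq_sum_wordVec (b : HilbertBasis (FreeMonoid (Fin n)) ℂ H)
    (w : FreeMonoid (Fin n)) :
    cycGradVec b w =
      ∑ m ∈ Finset.range (FreeMonoid.toList w).length, wordVec b ((FreeMonoid.toList w).rotate m) := by
  rw [Finset.sum_range]
  ext j
  simp only [cycGradVec, WithLp.equiv_symm_apply, WithLp.ofLp_sum, Finset.sum_apply]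
  refine Finset.sum_congr rfl fun m _ => ?_
  rw [List.rotate_eq_drop_append_take m.2.le, List.drop_eq_getElem_cons m.2, List.cons_append,
    wordVec]
  simp [eq_comm]

lemma adjoint_apply_of_mul (b : HilbertBasis (FreeMonoid (Fin n)) ℂ H) {L : Fin n → H →L[ℂ] H}
    (hL : ∀ (j : Fin n) (w : FreeMonoid (Fin n)), L j (b w) = b (FreeMonoid.of j * w))
    (i j : Fin n) (v : FreeMonoid (Fin n)) :
    ContinuousLinearMap.adjoint (L j) (b (FreeMonoid.of i * v)) = if j = i then b v else 0 := by
  classical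
  refine b.ext_inner_left fun u => ?_
  have key : FreeMonoid.of j * u = FreeMonoid.of i * v ↔ j = i ∧ u = v := List.cons_eq_cons
  rw [ContinuousLinearMap.adjoint_inner_right, hL, b.inner_eq_ite]
  by_cases hji : j = i
  · simp only [key, if_pos hji, and_iff_right hji, b.inner_eq_ite]
  · simp [key, hji]

lemma adjoint_apply_mul_of (b : HilbertBasis (FreeMonoid (Fin n)) ℂ H) {R : Fin n → H →L[ℂ] H}
    (hR : ∀ (j : Fin n) (w : FreeMonoid (Fin n)), R j (b w) = b (w * FreeMonoid.of j))
    (i j : Fin n) (v : FreeMonoid (Fin n)) :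
    ContinuousLinearMap.adjoint (R j) (b (v * FreeMonoid.of i)) = if j = i then b v else 0 := by
  classical
  refine b.ext_inner_left fun u => ?_
  have key : u * FreeMonoid.of j = v * FreeMonoid.of i ↔ u = v ∧ j = i :=
    List.append_singleton_inj
  rw [ContinuousLinearMap.adjoint_inner_right, hR, b.inner_eq_ite]
  by_cases hji : j = i
  · simp only [key, if_pos hji, and_iff_left hji, b.inner_eq_ite]
  · simp [key, hji]

lemma creationDiffVec_rotate_one (b : HilbertBasis (FreeMonoid (Fin n)) ℂ H)
    {L R : Fin n → H →L[ℂ] H}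
    (hL : ∀ (j : Fin n) (w : FreeMonoid (Fin n)), L j (b w) = b (FreeMonoid.of j * w))
    (hR : ∀ (j : Fin n) (w : FreeMonoid (Fin n)), R j (b w) = b (w * FreeMonoid.of j))
    {u : List (Fin n)} (hu : u ≠ []) :
    creationDiffVec b L R (FreeMonoid.ofList (u.rotate 1)) =
      wordVec b (u.rotate 1) - wordVec b u := by
  have hleft : ∀ (v : List (Fin n)) (j : Fin n), v ≠ [] →
      ContinuousLinearMap.adjoint (L j) (b (FreeMonoid.ofList v)) = wordVec b v j := by
    rintro (_ | ⟨i, v⟩) j hv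
    · exact absurd rfl hv
    · rw [FreeMonoid.ofList_cons, adjoint_apply_of_mul b hL]
      simp [wordVec]
  ext j
  change (ContinuousLinearMap.adjoint (L j) - ContinuousLinearMap.adjoint (R j))
    (b (FreeMonoid.ofList (u.rotate 1))) = wordVec b (u.rotate 1) j - wordVec b u j
  rw [sub_apply, hleft _ _ (by simpa using hu)]
  congr 1
  cases u with
  | nil => exact absurd rfl hu
  | cons i v =>
    rw [List.rotate_cons_succ, List.rotate_zero, FreeMonoid.ofList_append,
      FreeMonoid.ofList_singleton, adjoint_apply_mul_of b hR]
    simp [wordVec]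

lemma exists_rotate_one_eq {α : Type*} (w : List α) : ∃ u : List α, u.rotate 1 = w := by
  rcases List.eq_nil_or_concat w with rfl | ⟨v, i, rfl⟩
  · exact ⟨[], rfl⟩
  · exact ⟨i :: v, by simp⟩

lemma creationDiffVec_set_eq (b : HilbertBasis (FreeMonoid (Fin n)) ℂ H)
    {L R : Fin n → H →L[ℂ] H}
    (hL : ∀ (j : Fin n) (w : FreeMonoid (Fin n)), L j (b w) = b (FreeMonoid.of j * w))
    (hR : ∀ (j : Fin n) (w : FreeMonoid (Fin n)), R j (b w) = b (w * FreeMonoid.of j)) :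
    {x : PiLp 2 (fun _ : Fin n => H) |
        ∃ w : FreeMonoid (Fin n), w ≠ 1 ∧ x = creationDiffVec b L R w} =
      {x | ∃ u : List (Fin n), u ≠ [] ∧ x = wordVec b (u.rotate 1) - wordVec b u} := by
  ext x
  constructor
  · rintro ⟨w, hw, rfl⟩
    obtain ⟨u, hu⟩ := exists_rotate_one_eq (FreeMonoid.toList w)
    obtain rfl : FreeMonoid.ofList (u.rotate 1) = w := by rw [hu, FreeMonoid.ofList_toList]
    have hne : u ≠ [] := by
      rintro rfl
      exact hw rfl
    exact ⟨u, hne, creationDiffVec_rotate_one b hL hR hne⟩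
  · rintro ⟨u, hu, rfl⟩
    refine ⟨FreeMonoid.ofList (u.rotate 1), fun h => hu ?_,
      (creationDiffVec_rotate_one b hL hR hu).symm⟩
    exact List.rotate_eq_nil_iff.mp (FreeMonoid.ofList.injective h)

end

/-- Theorem 7.5: in `H^n = (ℓ²(W))^n`, the orthogonal complement of the closed linear
span of the evaluated cyclic gradients `{G_w : w ∈ W}` is the closed linear span of
`{F_w = ((ℓ_j*−r_j*)e_w)_j : w ∈ W, w ≠ ∅}`. -/
theorem orthogonal_of_cyclic_gradients
    {n : ℕ} {H : Type*} [NormedAddCommGroup H] [InnerProductSpace ℂ H] [CompleteSpace H]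
    (b : HilbertBasis (FreeMonoid (Fin n)) ℂ H)
    (L Rop : Fin n → H →L[ℂ] H)
    (hL : ∀ (j : Fin n) (w : FreeMonoid (Fin n)), L j (b w) = b (FreeMonoid.of j * w))
    (hR : ∀ (j : Fin n) (w : FreeMonoid (Fin n)), Rop j (b w) = b (w * FreeMonoid.of j)) :
    ((Submodule.span ℂ (Set.range (cycGradVec b))).topologicalClosure)ᗮ =
      (Submodule.span ℂ
          {x : PiLp 2 (fun _ : Fin n => H) |
            ∃ w : FreeMonoid (Fin n), w ≠ 1 ∧ x = creationDiffVec b L Rop w}).topologicalClosure := by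
  rw [creationDiffVec_set_eq b hL hR, Submodule.orthogonal_closure]
  set F : Set (PiLp 2 (fun _ : Fin n => H)) :=
    {x | ∃ u : List (Fin n), u ≠ [] ∧ x = wordVec b (u.rotate 1) - wordVec b u}
  have hle : (Submodule.span ℂ F).topologicalClosure ≤
      (Submodule.span ℂ (Set.range (cycGradVec b)))ᗮ := by
    refine Submodule.topologicalClosure_minimal _ ?_ (Submodule.isClosed_orthogonal _)
    rw [← Submodule.isOrtho_iff_le, Submodule.isOrtho_comm, Submodule.isOrtho_span]
    rintro _ ⟨w, rfl⟩ _ ⟨u, -, rfl⟩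
    rw [cycGradVec_eq_sum_wordVec]
    exact inner_sum_rotate_wordVec_sub b _ u
  have hbot : (Submodule.span ℂ F).topologicalClosureᗮ ⊓
      (Submodule.span ℂ (Set.range (cycGradVec b)))ᗮ = ⊥ := by
    rw [eq_bot_iff]
    rintro x ⟨hxF, hxG⟩
    refine eq_zero_of_inner_wordVec_eq_zero b fun u hu => ?_
    have hrot : ∀ m, inner ℂ (wordVec b (u.rotate m)) x = inner ℂ (wordVec b u) x := by
      intro m
      induction m with
      | zero => simp
      | succ m ih =>
        have hmem : wordVec b ((u.rotate m).rotate 1) - wordVec b (u.rotate m) ∈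
            (Submodule.span ℂ F).topologicalClosure :=
          Submodule.le_topologicalClosure _
            (Submodule.subset_span ⟨u.rotate m, by simpa using hu, rfl⟩)
        have h := hxF _ hmem
        rw [inner_sub_left, sub_eq_zero, List.rotate_rotate] at h
        rw [h, ih]
    have h := hxG _ (Submodule.subset_span (Set.mem_range_self (FreeMonoid.ofList u)))
    rw [cycGradVec_eq_sum_wordVec, sum_inner, FreeMonoid.toList_ofList,
      Finset.sum_congr rfl fun m _ => hrot m] at h
    simpa [hu] using h
  have hsup := Submodule.sup_orthogonal_inf_of_hasOrthogonalProjection hle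
  rw [hbot, sup_bot_eq] at hsup
  exact hsup.symm
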